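/- Let a be a real number with 0 < a < 2 and let s > 2 be real. Then Σ_{x ∈ D₄} (a + ‖x‖²)^{−s} = a^{−s} + Σ_{k=0}^{∞} ((−1)^k a^k / k!) · (Γ(s+k)/Γ(s)) · ζ_{D₄}(s+k). (The minimum squared norm of a nonzero vector of D₄ is 2, which is why the expansion is valid for all a < 2.) -/

import Mathlib

open scoped BigOperators

/-- The Epstein zeta function of the checkerboard lattice `D₄`. -/
noncomputable def epsteinD4 (s : ℝ) : ℝ :=
  ∑' x : {x : Fin 4 → ℤ // Even (∑ i, x i) ∧ x ≠ 0}, (∑ i, ((x.1 i : ℝ)) ^ 2) ^ (-s)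

/-- The binomial series of `(1 - y) ^ (-s)` with its coefficients written as Gamma quotients. -/
theorem hasSum_gamma_binomial {s : ℝ} (hs : 0 < s) {y : ℝ} (hy : |y| < 1) :
    HasSum (fun k : ℕ ↦ Real.Gamma (s + k) / Real.Gamma s / (k.factorial : ℝ) * y ^ k)
      ((1 - y) ^ (-s)) := by
  have hG : ∀ k : ℕ, Real.Gamma (s + k) / Real.Gamma s = (ascPochhammer ℝ k).eval s := by
    intro k
    rw [div_eq_iff (Real.Gamma_pos_of_pos hs).ne']
    induction k with
    | zero => simp
    | succ k ih =>
      rw [Nat.cast_succ, ← add_assoc, Real.Gamma_add_one (by positivity), ih,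
        ascPochhammer_succ_eval]
      ring
  have hc : ∀ k : ℕ, Real.Gamma (s + k) / Real.Gamma s / (k.factorial : ℝ)
      = Ring.choose (s + k - 1) k := by
    intro k
    rw [← Ring.multichoose_eq, div_eq_iff (by positivity), hG,
      ← Polynomial.ascPochhammer_smeval_eq_eval, ← Ring.factorial_nsmul_multichoose_eq_ascPochhammer,
      nsmul_eq_mul, mul_comm]
  have h := (Real.one_div_one_sub_rpow_hasFPowerSeriesOnBall_zero s).hasSum (y := y) (by
    rw [← ENNReal.ofReal_one, Metric.eball_ofReal]
    simpa using hy)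
  have hpos : 0 ≤ 1 - y := by linarith [(abs_lt.mp hy).2]
  simpa [hc, Real.rpow_neg hpos, mul_comm] using h

/-- The binomial expansion of `(a + q) ^ (-s)` in powers of `a`. -/
theorem hasSum_add_rpow_neg {s a q : ℝ} (hs : 0 < s) (ha : 0 < a) (haq : a < q) :
    HasSum (fun k : ℕ ↦ (-1 : ℝ) ^ k * a ^ k / (k.factorial : ℝ) *
      (Real.Gamma (s + k) / Real.Gamma s) * q ^ (-(s + k))) ((a + q) ^ (-s)) := by
  have hq : 0 < q := ha.trans haq
  have h := (hasSum_gamma_binomial hs (y := -(a / q)) (by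
    rw [abs_neg, abs_of_pos (by positivity), div_lt_one hq]
    exact haq)).mul_right (q ^ (-s))
  have h1 : (1 - -(a / q)) ^ (-s) * q ^ (-s) = (a + q) ^ (-s) := by
    rw [← Real.mul_rpow (by rw [sub_neg_eq_add]; positivity) hq.le]
    congr 1
    field_simp
    ring
  rw [h1] at h
  convert! h using 2 with k
  rw [neg_add, Real.rpow_add hq, Real.rpow_neg hq.le (k : ℝ), Real.rpow_natCast, neg_pow (a / q),
    div_pow]
  ring

/-- Convergence of the Epstein zeta series of `ℤᵈ`. -/
theorem summable_sum_sq_rpow_neg {ι : Type*} [Fintype ι] {s : ℝ}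
    (hs : (Fintype.card ι : ℝ) / 2 < s) :
    Summable fun x : ι → ℤ ↦ (∑ i, (x i : ℝ) ^ 2) ^ (-s) := by
  classical
  let b := (EuclideanSpace.basisFun ι ℝ).toBasis
  let L : Submodule ℤ (EuclideanSpace ℝ ι) := Submodule.span ℤ (Set.range b)
  let B : Module.Basis ι ℤ L := b.restrictScalars ℤ
  have hr : Module.finrank ℤ L = Fintype.card ι := Module.finrank_eq_card_basis B
  have h := ZLattice.summable_norm_rpow L (-(2 * s)) (by rw [hr]; linarith)
  have h2 := h.comp_injective B.equivFun.symm.injective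
  refine h2.congr fun x ↦ ?_
  have hn : ‖B.equivFun.symm x‖ = √(∑ i, (x i : ℝ) ^ 2) := by
    rw [Submodule.coe_norm, EuclideanSpace.norm_eq]
    congr 1
    refine Finset.sum_congr rfl fun i _ ↦ ?_
    have hB : ∀ j, ((B j : L) : EuclideanSpace ℝ ι) = EuclideanSpace.single j 1 := fun j ↦
      (b.restrictScalars_apply ℤ j).trans (by simp [b])
    simp [Module.Basis.equivFun_symm_apply, hB, Pi.single_apply]
  have h0 : (0 : ℝ) ≤ ∑ i, (x i : ℝ) ^ 2 := by positivity
  simp only [Function.comp_apply, hn]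
  rw [Real.sqrt_eq_rpow, ← Real.rpow_mul h0]
  congr 1
  ring

/-- Nonzero integer vectors with even coordinate sum have squared norm at least `2`. -/
theorem two_le_sum_sq_of_even_sum {ι : Type*} [Fintype ι] {x : ι → ℤ} (hx : Even (∑ i, x i))
    (h0 : x ≠ 0) : (2 : ℝ) ≤ ∑ i, (x i : ℝ) ^ 2 := by
  have he : Even (∑ i, x i ^ 2) := by
    have h : Even (∑ i, (x i ^ 2 - x i)) := Finset.even_sum _ fun i _ ↦ by
      rw [Int.even_sub, Int.even_pow' two_ne_zero]
    rw [Finset.sum_sub_distrib] at h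
    simpa using h.add hx
  obtain ⟨j, hj⟩ := Function.ne_iff.mp h0
  have hpos : 0 < ∑ i, x i ^ 2 :=
    Finset.sum_pos' (fun i _ ↦ sq_nonneg _) ⟨j, Finset.mem_univ j, by simpa using sq_pos_of_ne_zero hj⟩
  have h2 : (2 : ℤ) ≤ ∑ i, x i ^ 2 := by
    obtain ⟨m, hm⟩ := he
    omega
  exact_mod_cast h2

/-- For `0 < a < 2` and real `s > 2`,
`∑_{x ∈ D₄} (a+‖x‖²)^{-s} = a^{-s} + ∑_{k≥0} ((-1)^k a^k/k!) (Γ(s+k)/Γ(s)) ζ_{D₄}(s+k)`;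
the expansion is valid for all `a < 2` since the minimal squared norm of a nonzero vector
of `D₄` is `2`. -/
theorem hurwitz_epstein_D4_two (a : ℝ) (ha : 0 < a) (ha2 : a < 2) (s : ℝ) (hs : 2 < s) :
    ∑' x : {x : Fin 4 → ℤ // Even (∑ i, x i)}, (a + ∑ i, ((x.1 i : ℝ)) ^ 2) ^ (-s)
      = a ^ (-s)
        + ∑' k : ℕ, (-1 : ℝ) ^ k * a ^ k / (k.factorial : ℝ) *
            (Real.Gamma (s + k) / Real.Gamma s) * epsteinD4 (s + k) := by
  have hs0 : 0 < s := by linarith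
  set T := {x : Fin 4 → ℤ // Even (∑ i, x i) ∧ x ≠ 0}
  set Q : T → ℝ := fun x ↦ ∑ i, (x.1 i : ℝ) ^ 2
  have hQ2 : ∀ x, 2 ≤ Q x := fun x ↦ two_le_sum_sq_of_even_sum x.2.1 x.2.2
  have hsumQ : Summable fun x ↦ Q x ^ (-s) :=
    (summable_sum_sq_rpow_neg (ι := Fin 4) (s := s) (by norm_num; linarith)).comp_injective
      Subtype.val_injective
  have hexp : ∀ x, HasSum (fun k : ℕ ↦ (-1 : ℝ) ^ k * a ^ k / (k.factorial : ℝ) *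
      (Real.Gamma (s + k) / Real.Gamma s) * Q x ^ (-(s + k))) ((a + Q x) ^ (-s)) :=
    fun x ↦ hasSum_add_rpow_neg hs0 ha (ha2.trans_le (hQ2 x))
  have hcoef : Summable fun k : ℕ ↦
      Real.Gamma (s + k) / Real.Gamma s / (k.factorial : ℝ) * (a / 2) ^ k :=
    (hasSum_gamma_binomial hs0 (by rw [abs_of_pos] <;> linarith)).summable
  have hGpos : ∀ k : ℕ, 0 < Real.Gamma (s + k) / Real.Gamma s := fun k ↦
    div_pos (Real.Gamma_pos_of_pos (by positivity)) (Real.Gamma_pos_of_pos hs0)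
  have hdouble : Summable (Function.uncurry fun (k : ℕ) (x : T) ↦
      (-1 : ℝ) ^ k * a ^ k / (k.factorial : ℝ) *
        (Real.Gamma (s + k) / Real.Gamma s) * Q x ^ (-(s + k))) := by
    refine (hcoef.mul_of_nonneg hsumQ (fun k ↦ ?_) fun x ↦ ?_).of_norm_bounded ?_
    · have := hGpos k
      simp only [Pi.zero_apply]
      positivity
    · have := hQ2 x
      simp only [Pi.zero_apply]
      positivity
    · rintro ⟨k, x⟩
      have hq : 0 < Q x := by linarith [hQ2 x]
      have hG := hGpos k
      have hle : Q x ^ (-(s + k)) ≤ (1 / 2) ^ k * Q x ^ (-s) := by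
        rw [neg_add, Real.rpow_add hq, Real.rpow_neg hq.le (k : ℝ), Real.rpow_natCast, mul_comm,
          ← inv_pow]
        gcongr
        rw [one_div]
        exact inv_anti₀ two_pos (hQ2 x)
      simp only [Function.uncurry_apply_pair, norm_mul, norm_div, norm_pow, norm_neg, norm_one,
        one_pow, one_mul, Real.norm_natCast]
      rw [← norm_div, Real.norm_of_nonneg ha.le, Real.norm_of_nonneg hG.le,
        Real.norm_of_nonneg (by positivity)]
      calc _ ≤ a ^ k / (k.factorial : ℝ) * (Real.Gamma (s + k) / Real.Gamma s) *
            ((1 / 2) ^ k * Q x ^ (-s)) := by gcongr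
        _ = _ := by
          rw [div_pow, div_pow]
          ring
  have hmain : ∑' x, (a + Q x) ^ (-s) = ∑' k : ℕ, (-1 : ℝ) ^ k * a ^ k / (k.factorial : ℝ) *
      (Real.Gamma (s + k) / Real.Gamma s) * epsteinD4 (s + k) := by
    rw [tsum_congr fun x ↦ (hexp x).tsum_eq.symm, hdouble.tsum_comm]
    refine tsum_congr fun k ↦ ?_
    rw [tsum_mul_left]
    rfl
  have hsumA : Summable fun x : T ↦ (a + Q x) ^ (-s) := by
    refine hsumQ.of_nonneg_of_le (fun x ↦ ?_) fun x ↦ ?_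
    · have := hQ2 x
      positivity
    · have := hQ2 x
      exact Real.rpow_le_rpow_of_nonpos (by linarith) (by linarith) (by linarith)
  rw [← hmain]
  have hU : {x : Fin 4 → ℤ | Even (∑ i, x i)} = {0} ∪ {x | Even (∑ i, x i) ∧ x ≠ 0} := by
    ext x
    by_cases h : x = 0 <;> simp [h]
  have hsplit := Summable.tsum_union_disjoint (s := {(0 : Fin 4 → ℤ)})
    (t := {x | Even (∑ i, x i) ∧ x ≠ 0})
    (f := fun x : Fin 4 → ℤ ↦ (a + ∑ i, (x i : ℝ) ^ 2) ^ (-s))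
    (by simp) ((Set.finite_singleton _).summable _) hsumA
  rw [← hU, tsum_singleton 0 (fun x : Fin 4 → ℤ ↦ (a + ∑ i, (x i : ℝ) ^ 2) ^ (-s))] at hsplit
  simp only [Pi.zero_apply, Int.cast_zero, ne_eq, OfNat.ofNat_ne_zero, not_false_eq_true,
    zero_pow, Finset.sum_const_zero, add_zero] at hsplit
  exact hsplit
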